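/- arXiv:2307.11160 — 3 statements merged into one kernel-verified Lean document; each statement's English description precedes it below -/
import Mathlib

section
/- Let n ≥ 2 be even, c > 0 and φ ≥ 0. Let M ∈ Sym₀(ℝ^n) be the matrix with M_{2i−1,2i} = M_{2i,2i−1} = φ/c for i = 1,…,n/2 and all other entries zero. Then M has a feasible decomposition λ with at most 2^⌈log₂(n/2)⌉ < n nonzero values and with Σ_m λ(m) = φ/c, and T(M) = φ/c. -/
/-- The sign `m = (−1)^b` of a bit: encodings `m ∈ {−1,+1}^n` are represented by
boolean vectors `b : Fin n → Bool` via `m i = sgn (b i)`. -/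
def sgn (b : Bool) : ℝ := if b then -1 else 1

/-- `lam` is a feasible decomposition of `M ∈ Sym₀(ℝ^n)`:
`lam ≥ 0` and `M i j = Σ_{m ∈ {−1,+1}^n} lam m * m_i * m_j` for all `i ≠ j`. -/
def IsDecomp {n : ℕ} (M : Matrix (Fin n) (Fin n) ℝ)
    (lam : (Fin n → Bool) → ℝ) : Prop :=
  (∀ m, 0 ≤ lam m) ∧
  ∀ i j : Fin n, i ≠ j →
    M i j = ∑ m : Fin n → Bool, lam m * sgn (m i) * sgn (m j)

/-- The optimal gate time `T(M)`: infimum of `Σ_m lam m` over feasible decompositions. -/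
noncomputable def gateTime {n : ℕ} (M : Matrix (Fin n) (Fin n) ℝ) : ℝ :=
  sInf { t | ∃ lam, IsDecomp M lam ∧ ∑ m : Fin n → Bool, lam m = t }

lemma sgn_mul_sgn_le_one (a b : Bool) : sgn a * sgn b ≤ 1 := by
  cases a <;> cases b <;> norm_num [sgn]

lemma sgn_mul_self (a : Bool) : sgn a * sgn a = 1 := by
  cases a <;> norm_num [sgn]

/-- The Walsh sign vector with frequency `u`, constant on each pair of indices
`a`, `b` with `⌊a/2⌋ = ⌊b/2⌋`. -/
def walshVector (n k : ℕ) (u : Fin k → Bool) : Fin n → Bool := fun a =>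
  decide (Odd (Finset.univ.filter fun j : Fin k => (u j && ((a : ℕ) / 2).testBit j) = true).card)

lemma sgn_walshVector {n k : ℕ} (u : Fin k → Bool) (a : Fin n) :
    sgn (walshVector n k u a) = ∏ j : Fin k, sgn (u j && ((a : ℕ) / 2).testBit j) := by
  simp only [sgn, Finset.prod_ite, Finset.prod_const, one_pow, mul_one,
    walshVector, decide_eq_true_eq]
  split_ifs with h
  · exact (Odd.neg_one_pow h).symm
  · exact (Nat.not_odd_iff_even.mp h).neg_one_pow.symm

lemma sum_sgn_walshVector_mul {n k : ℕ} (a b : Fin n) (ha : (a : ℕ) / 2 < 2 ^ k)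
    (hb : (b : ℕ) / 2 < 2 ^ k) (hab : (a : ℕ) / 2 ≠ (b : ℕ) / 2) :
    ∑ u : Fin k → Bool, sgn (walshVector n k u a) * sgn (walshVector n k u b) = 0 := by
  obtain ⟨i, hi⟩ := Nat.exists_testBit_ne_of_ne hab
  have hik : i < k := by
    by_contra! h
    have hpow : 2 ^ k ≤ 2 ^ i := Nat.pow_le_pow_right two_pos h
    rw [Nat.testBit_lt_two_pow (ha.trans_le hpow),
      Nat.testBit_lt_two_pow (hb.trans_le hpow)] at hi
    exact hi rfl
  simp only [sgn_walshVector, ← Finset.prod_mul_distrib]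
  rw [← Fintype.prod_sum fun (j : Fin k) (x : Bool) =>
    sgn (x && ((a : ℕ) / 2).testBit j) * sgn (x && ((b : ℕ) / 2).testBit j)]
  refine Finset.prod_eq_zero (Finset.mem_univ ⟨i, hik⟩) ?_
  revert hi
  cases ((a : ℕ) / 2).testBit i <;> cases ((b : ℕ) / 2).testBit i <;> simp [sgn]

/-- The push-forward along `f` of the measure giving each point of `ι` the weight `w`. -/
noncomputable def pushWeight {ι α : Type*} [Fintype ι] [DecidableEq α] (w : ℝ) (f : ι → α) :
    α → ℝ := fun m => ∑ u, if f u = m then w else 0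

lemma sum_pushWeight_mul {ι α : Type*} [Fintype ι] [Fintype α] [DecidableEq α] (w : ℝ)
    (f : ι → α) (g : α → ℝ) :
    ∑ m, pushWeight w f m * g m = w * ∑ u, g (f u) := by
  simp only [pushWeight, Finset.sum_mul, Finset.mul_sum]
  rw [Finset.sum_comm]
  simp

lemma ncard_support_pushWeight_le {ι α : Type*} [Fintype ι] [DecidableEq α] (w : ℝ)
    (f : ι → α) : {m | pushWeight w f m ≠ 0}.ncard ≤ Fintype.card ι := by
  have hsub : {m | pushWeight w f m ≠ 0} ⊆ f '' Set.univ := by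
    intro m hm
    obtain ⟨u, -, hu⟩ := Finset.exists_ne_zero_of_sum_ne_zero hm
    exact ⟨u, trivial, by_contra fun h => hu (if_neg h)⟩
  calc _ ≤ (f '' Set.univ).ncard := Set.ncard_le_ncard hsub (Set.toFinite _)
    _ ≤ (Set.univ : Set ι).ncard := Set.ncard_image_le
    _ = Fintype.card ι := by rw [Set.ncard_univ, Nat.card_eq_fintype_card]

lemma IsDecomp.le_sum {n : ℕ} {M : Matrix (Fin n) (Fin n) ℝ} {lam : (Fin n → Bool) → ℝ}
    (h : IsDecomp M lam) {i j : Fin n} (hij : i ≠ j) : M i j ≤ ∑ m, lam m := by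
  rw [h.2 i j hij]
  refine Finset.sum_le_sum fun m _ => ?_
  rw [mul_assoc]
  exact mul_le_of_le_one_right (h.1 m) (sgn_mul_sgn_le_one _ _)

lemma two_pow_clog_half_lt {n : ℕ} (hn : 2 ≤ n) : 2 ^ Nat.clog 2 (n / 2) < n := by
  rcases Nat.lt_or_ge 1 (n / 2) with h | h
  · have hpos := Nat.clog_pos one_lt_two h
    have hlt := Nat.pow_pred_clog_lt_self one_lt_two h
    obtain ⟨k, hk⟩ := Nat.exists_eq_succ_of_ne_zero hpos.ne'
    rw [hk] at hlt ⊢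
    rw [Nat.pred_succ] at hlt
    rw [pow_succ]
    omega
  · rw [Nat.clog_of_right_le_one h]
    omega


/-- `n` even, `M ∈ Sym₀(ℝ^n)` with `M_{2i−1,2i} = M_{2i,2i−1} = φ/c`
(pairs `{2i−1, 2i}`, i.e. 0-based indices `a ≠ b` with `⌊a/2⌋ = ⌊b/2⌋`) and zeros elsewhere.
Then `M` has a feasible decomposition with at most `2^⌈log₂(n/2)⌉ < n` nonzero values and
total `φ/c`, and `T(M) = φ/c`. -/
theorem stmt_4 {n : ℕ} (hn : 2 ≤ n) (hev : Even n) (c φ : ℝ) (hc : 0 < c) (hφ : 0 ≤ φ)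
    (M : Matrix (Fin n) (Fin n) ℝ)
    (hM : ∀ a b : Fin n, M a b =
      if a ≠ b ∧ (a : ℕ) / 2 = (b : ℕ) / 2 then φ / c else 0) :
    (∃ lam : (Fin n → Bool) → ℝ, IsDecomp M lam ∧
      {m | lam m ≠ 0}.ncard ≤ 2 ^ (Nat.clog 2 (n / 2)) ∧
      ∑ m : Fin n → Bool, lam m = φ / c) ∧
    2 ^ (Nat.clog 2 (n / 2)) < n ∧
    gateTime M = φ / c := by
  obtain ⟨lam, hdec, hcard, hsum⟩ : ∃ lam : (Fin n → Bool) → ℝ, IsDecomp M lam ∧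
      {m | lam m ≠ 0}.ncard ≤ 2 ^ (Nat.clog 2 (n / 2)) ∧
      ∑ m : Fin n → Bool, lam m = φ / c := by
    set k := Nat.clog 2 (n / 2)
    have hlt (a : Fin n) : (a : ℕ) / 2 < 2 ^ k := by
      have hle : n / 2 ≤ 2 ^ k := Nat.le_pow_clog one_lt_two _
      obtain ⟨r, rfl⟩ := hev
      omega
    have hw : φ / c / 2 ^ k * 2 ^ k = φ / c := div_mul_cancel₀ _ (by positivity)
    refine ⟨pushWeight (φ / c / 2 ^ k) (walshVector n k), ⟨fun m => ?_, fun i j hij => ?_⟩,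
      ?_, ?_⟩
    · exact Finset.sum_nonneg fun u _ => by split_ifs <;> positivity
    · simp only [mul_assoc]
      rw [sum_pushWeight_mul _ _ fun m : Fin n → Bool => sgn (m i) * sgn (m j), hM]
      split_ifs with h
      · have hpair (u : Fin k → Bool) : walshVector n k u i = walshVector n k u j := by
          simp only [walshVector, h.2]
        simp [hpair, sgn_mul_self, hw]
      · rw [sum_sgn_walshVector_mul i j (hlt i) (hlt j) fun h' => h ⟨hij, h'⟩, mul_zero]
    · simpa using ncard_support_pushWeight_le (φ / c / 2 ^ k) (walshVector n k)
    · simpa [hw] using sum_pushWeight_mul (φ / c / 2 ^ k) (walshVector n k) fun _ => 1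
  refine ⟨⟨lam, hdec, hcard, hsum⟩, two_pow_clog_half_lt hn, ?_⟩
  refine IsLeast.csInf_eq ⟨⟨lam, hdec, hsum⟩, ?_⟩
  rintro t ⟨mu, hmu, rfl⟩
  have hne : (⟨0, by omega⟩ : Fin n) ≠ ⟨1, by omega⟩ := by simp
  simpa [hM] using hmu.le_sum hne
end

section
/- Let n ≥ 2 and let E_n denote the n×n all-ones matrix minus the identity. Then (a) for every m ∈ {−1,+1}^n one has −(1/⌊n/2⌋)·Σ_{1≤i<j≤n} m_i m_j ≤ 1, and (b) every feasible decomposition λ of −E_n satisfies Σ_m λ(m) ≥ C(n,2)/⌊n/2⌋, which equals n if n is odd and n−1 if n is even. -/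
open Finset in
/-- The square of a sum splits into the squares and twice the products over ordered pairs. -/
theorem sq_sum_eq_sum_sq_add_two_mul {R ι : Type*} [CommRing R] [Fintype ι] [LinearOrder ι]
    (f : ι → R) :
    (∑ i, f i) ^ 2 = ∑ i, f i ^ 2 +
      2 * ∑ p ∈ univ.filter (fun p : ι × ι => p.1 < p.2), f p.1 * f p.2 := by
  have hswap : ∑ p ∈ univ.filter (fun p : ι × ι => p.2 < p.1), f p.1 * f p.2 =
      ∑ p ∈ univ.filter (fun p : ι × ι => p.1 < p.2), f p.1 * f p.2 := by
    refine sum_nbij' Prod.swap Prod.swap ?_ ?_ ?_ ?_ ?_ <;> simp [mul_comm]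
  have hdiag : ∑ i, f i ^ 2 = ∑ p : ι × ι, if p.1 = p.2 then f p.1 * f p.2 else 0 := by
    simp [Fintype.sum_prod_type, sq]
  rw [two_mul]
  nth_rewrite 2 [← hswap]
  rw [hdiag, sum_filter, sum_filter, ← sum_add_distrib, ← sum_add_distrib, sq,
    Fintype.sum_mul_sum, ← Fintype.sum_prod_type']
  refine sum_congr rfl fun p _ => ?_
  rcases lt_trichotomy p.1 p.2 with h | h | h
  · simp [h, h.ne, h.not_gt]
  · simp [h]
  · simp [h, h.ne', h.not_gt]

open Finset in
theorem card_filter_lt_eq_choose_two (n : ℕ) :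
    #(univ.filter (fun p : Fin n × Fin n => p.1 < p.2)) = n.choose 2 := by
  have h := sq_sum_eq_sum_sq_add_two_mul (fun _ : Fin n => (1 : ℚ))
  simp only [sum_const, card_univ, Fintype.card_fin, nsmul_eq_mul, mul_one, one_pow] at h
  have hc := Nat.cast_choose_two ℚ n
  have : (#(univ.filter (fun p : Fin n × Fin n => p.1 < p.2)) : ℚ) = n.choose 2 := by
    rw [hc]
    linarith
  exact_mod_cast this

open Finset in
/-- The sum of pairwise products of `n` signs is at least `-⌊n/2⌋`. -/
theorem neg_sum_lt_mul_le_half {n : ℕ} (m : Fin n → ℝ) (hm : ∀ i, m i = 1 ∨ m i = -1) :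
    -(∑ p ∈ univ.filter (fun p : Fin n × Fin n => p.1 < p.2), m p.1 * m p.2) ≤
      ((n / 2 : ℕ) : ℝ) := by
  have hz : ∀ i, ∃ z : ℤ, m i = z ∧ z ^ 2 = 1 := fun i => by
    rcases hm i with h | h
    · exact ⟨1, by simp [h], by norm_num⟩
    · exact ⟨-1, by simp [h], by norm_num⟩
  choose z hmz hz using hz
  have h := sq_sum_eq_sum_sq_add_two_mul z
  simp only [hz, sum_const, card_univ, Fintype.card_fin, nsmul_eq_mul, mul_one] at h
  have h0 := sq_nonneg (∑ i, z i)
  have key : -(∑ p ∈ univ.filter (fun p : Fin n × Fin n => p.1 < p.2), z p.1 * z p.2) ≤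
      ((n / 2 : ℕ) : ℤ) := by
    omega
  have hcast := (Int.cast_le (R := ℝ)).mpr key
  simpa only [hmz, Int.cast_natCast, Int.cast_neg, Int.cast_sum, Int.cast_mul] using hcast

theorem choose_two_div_half {n : ℕ} (hn : 2 ≤ n) :
    (n.choose 2 : ℝ) / ((n / 2 : ℕ) : ℝ) = if Odd n then (n : ℝ) else (n : ℝ) - 1 := by
  have hk : ((n / 2 : ℕ) : ℝ) ≠ 0 := Nat.cast_ne_zero.mpr (by omega)
  rw [div_eq_iff hk, Nat.cast_choose_two]
  split_ifs with h
  · have h2 : ((2 * (n / 2) + 1 : ℕ) : ℝ) = n := by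
      rw [Nat.two_mul_div_two_add_one_of_odd h]
    push_cast at h2
    linear_combination (-(n : ℝ) / 2) * h2
  · have h2 : ((2 * (n / 2) : ℕ) : ℝ) = n := by
      rw [Nat.two_mul_div_two_of_even (Nat.not_odd_iff_even.mp h)]
    push_cast at h2
    linear_combination (-((n : ℝ) - 1) / 2) * h2


/-- (a) for every `m ∈ {−1,+1}^n`,
`−(1/⌊n/2⌋)·Σ_{i<j} m_i m_j ≤ 1` (the explicit dual feasible solution), and
(b) every feasible decomposition of `−E_n` (all entries `−1` off the diagonal, `0` on it)
has total at least `C(n,2)/⌊n/2⌋`, which equals `n` for odd `n` and `n−1` for even `n`. -/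
theorem stmt_11 {n : ℕ} (hn : 2 ≤ n) :
    (∀ m : Fin n → ℝ, (∀ i, m i = 1 ∨ m i = -1) →
      -(1 / ((n / 2 : ℕ) : ℝ)) *
        (∑ p ∈ Finset.univ.filter (fun p : Fin n × Fin n => p.1 < p.2),
          m p.1 * m p.2) ≤ 1) ∧
    (∀ lam : (Fin n → Bool) → ℝ,
      IsDecomp (Matrix.of fun i j : Fin n => if i = j then (0 : ℝ) else -1) lam →
      (n.choose 2 : ℝ) / ((n / 2 : ℕ) : ℝ) ≤ ∑ m : Fin n → Bool, lam m) ∧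
    ((n.choose 2 : ℝ) / ((n / 2 : ℕ) : ℝ) =
      if Odd n then (n : ℝ) else (n : ℝ) - 1) := by
  have hk : (0 : ℝ) < ((n / 2 : ℕ) : ℝ) := Nat.cast_pos.mpr (by omega)
  refine ⟨fun m hm => ?_, fun lam ⟨hpos, hdec⟩ => ?_, choose_two_div_half hn⟩
  · rw [neg_mul, ← mul_neg, one_div_mul_eq_div, div_le_one hk]
    exact neg_sum_lt_mul_le_half m hm
  · have hsgn : ∀ b, sgn b = 1 ∨ sgn b = -1 := by
      intro b
      cases b <;> simp [sgn]
    rw [div_le_iff₀ hk, Finset.sum_mul, ← card_filter_lt_eq_choose_two]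
    calc _ = ∑ p ∈ Finset.univ.filter (fun p : Fin n × Fin n => p.1 < p.2),
            -∑ m : Fin n → Bool, lam m * sgn (m p.1) * sgn (m p.2) := by
          rw [Finset.card_eq_sum_ones, Nat.cast_sum]
          refine Finset.sum_congr rfl fun p hp => ?_
          have hne : p.1 ≠ p.2 := (Finset.mem_filter.mp hp).2.ne
          rw [← hdec _ _ hne]
          simp [hne]
      _ = ∑ m : Fin n → Bool, lam m *
            -∑ p ∈ Finset.univ.filter (fun p : Fin n × Fin n => p.1 < p.2),
              sgn (m p.1) * sgn (m p.2) := by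
          rw [Finset.sum_neg_distrib, Finset.sum_comm]
          simp only [mul_neg, Finset.sum_neg_distrib, Finset.mul_sum, mul_assoc]
      _ ≤ _ := Finset.sum_le_sum fun m _ => mul_le_mul_of_nonneg_left
          (neg_sum_lt_mul_le_half _ fun i => hsgn (m i)) (hpos m)
end

section
/- Let n ≥ 2, set k = n if n is odd and k = n−1 if n is even, and let S = { b ∈ 𝔽₂^n : b_n = 0 and |b| ∈ {⌊n/2⌋, ⌈n/2⌉} }. Then |S| = C(k, ⌊k/2⌋), and for all i, j ∈ [n] with i ≠ j, Σ_{b ∈ S} (−1)^{b_i ⊕ b_j} = −(1/k)·C(k, ⌊k/2⌋). -/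
open Finset in
lemma card_filter_weight_eq (n m : ℕ) :
    #{b : Fin n → Bool | #{a | b a = true} = m} = n.choose m := by
  rw [show n.choose m = #(powersetCard m (univ : Finset (Fin n))) by simp]
  refine card_nbij' (fun b ↦ univ.filter fun a ↦ b a = true) (fun s a ↦ decide (a ∈ s)) ?_ ?_ ?_ ?_
  · intro b hb
    simpa [mem_powersetCard] using hb
  · intro s hs
    simpa [mem_powersetCard] using hs
  · intro b _
    funext a
    simp
  · intro s _
    ext a
    simp

open Finset in
lemma card_filter_not_apply_eq_true {n : ℕ} (b : Fin n → Bool) :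
    #{a | (!b a) = true} = n - #{a | b a = true} := by
  have h := card_filter_add_card_filter_not (s := (univ : Finset (Fin n))) (fun a ↦ b a = true)
  simp only [card_univ, Fintype.card_fin] at h
  simp only [Bool.not_eq_eq_eq_not, Bool.not_true, Bool.not_eq_true] at h ⊢
  omega

open Finset in
lemma card_filter_comp_perm {n : ℕ} (σ : Equiv.Perm (Fin n)) (b : Fin n → Bool) :
    #{a | b (σ a) = true} = #{a | b a = true} :=
  card_equiv σ (by simp)

/-- The vectors in `{0,1}^n` of weight `⌊n/2⌋` or `⌈n/2⌉`. -/
def middleLayers (n : ℕ) : Finset (Fin n → Bool) :=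
  {b | (Finset.univ.filter (fun a => b a = true)).card = n / 2 ∨
    (Finset.univ.filter (fun a => b a = true)).card = (n + 1) / 2}

open Finset in
lemma card_middleLayers {n k : ℕ} (hn : 2 ≤ n) (hk : k = if Odd n then n else n - 1) :
    #(middleLayers n) = 2 * k.choose (k / 2) := by
  rw [middleLayers]
  rcases Nat.even_or_odd' n with ⟨m, rfl | rfl⟩
  · obtain ⟨m, rfl⟩ : ∃ r, m = r + 1 := ⟨m - 1, by omega⟩
    rw [if_neg (by simp)] at hk
    rw [show (2 * (m + 1) + 1) / 2 = m + 1 by omega, show 2 * (m + 1) / 2 = m + 1 by omega]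
    simp only [or_self]
    rw [card_filter_weight_eq, hk, show 2 * (m + 1) - 1 = 2 * m + 1 by omega,
      show (2 * m + 1) / 2 = m by omega, show 2 * (m + 1) = 2 * m + 1 + 1 by ring,
      Nat.choose_succ_succ, Nat.choose_symm_half]
    ring
  · rw [if_pos (by simp)] at hk
    rw [show (2 * m + 1 + 1) / 2 = m + 1 by omega, hk, show (2 * m + 1) / 2 = m by omega,
      filter_or, card_union_of_disjoint, card_filter_weight_eq, card_filter_weight_eq,
      Nat.choose_symm_half]
    · ring
    · rw [disjoint_filter]
      intro b _ h
      omega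

open Finset in
/-- A complement-invariant function sums over the middle layers to twice its sum over the vectors
there whose coordinate at `l` vanishes. -/
lemma sum_middleLayers_eq_two_mul {n : ℕ} (l : Fin n) (f : (Fin n → Bool) → ℝ)
    (hf : ∀ b, f (fun a ↦ !b a) = f b) :
    ∑ b ∈ middleLayers n, f b = 2 * ∑ b ∈ middleLayers n with b l = false, f b := by
  have hmem : ∀ b ∈ middleLayers n, (fun a ↦ !b a) ∈ middleLayers n := by
    intro b hb
    have h := card_filter_not_apply_eq_true b
    simp only [middleLayers, mem_filter, mem_univ, true_and] at hb ⊢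
    omega
  rw [← sum_filter_add_sum_filter_not (middleLayers n) (fun b ↦ b l = false), two_mul]
  congr 1
  refine sum_nbij' (fun b a ↦ !b a) (fun b a ↦ !b a) ?_ ?_ ?_ ?_ ?_
  · intro b hb
    rw [mem_filter] at hb ⊢
    exact ⟨hmem b hb.1, by simpa using hb.2⟩
  · intro b hb
    rw [mem_filter] at hb ⊢
    exact ⟨hmem b hb.1, by simpa using hb.2⟩
  · intro b _
    simp
  · intro b _
    simp
  · intro b _
    exact (hf b).symm

open Finset in
lemma sum_middleLayers_agree_perm {n : ℕ} (σ : Equiv.Perm (Fin n)) (i j : Fin n) :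
    ∑ b ∈ middleLayers n, (if b (σ i) = b (σ j) then (1 : ℝ) else -1) =
      ∑ b ∈ middleLayers n, (if b i = b j then (1 : ℝ) else -1) := by
  refine sum_nbij' (fun b a ↦ b (σ a)) (fun b a ↦ b (σ.symm a)) ?_ ?_ ?_ ?_ ?_
  · intro b hb
    simpa [middleLayers, card_filter_comp_perm] using hb
  · intro b hb
    simpa [middleLayers, card_filter_comp_perm] using hb
  · intro b _
    simp
  · intro b _
    simp
  · intro b _
    rfl

open Finset in
lemma sum_middleLayers_agree_congr {n : ℕ} {i j i' j' : Fin n} (h : i ≠ j) (h' : i' ≠ j') :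
    ∑ b ∈ middleLayers n, (if b i' = b j' then (1 : ℝ) else -1) =
      ∑ b ∈ middleLayers n, (if b i = b j then (1 : ℝ) else -1) := by
  set σ := Equiv.swap i i'
  have hne : i' ≠ σ j := by
    rw [← Equiv.swap_apply_left i i']
    exact fun e ↦ h (σ.injective e)
  rw [← sum_middleLayers_agree_perm σ i j, ← sum_middleLayers_agree_perm
    (Equiv.swap (σ j) j') (σ i) (σ j), Equiv.swap_apply_left, Equiv.swap_apply_left,
    Equiv.swap_apply_of_ne_of_ne hne h']

open Finset in
lemma sum_sum_agree {n : ℕ} (b : Fin n → Bool) :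
    ∑ i, ∑ j, (if b i = b j then (1 : ℝ) else -1) = (2 * #{a | b a = true} - n : ℝ) ^ 2 := by
  have hs : ∑ i, (if b i = true then (1 : ℝ) else -1) = 2 * #{a | b a = true} - n := by
    have : ∀ i, (if b i = true then (1 : ℝ) else -1) = 2 * (if b i = true then 1 else 0) - 1 := by
      intro i
      split_ifs <;> norm_num
    simp only [this, sum_sub_distrib, ← mul_sum, sum_boole]
    simp
  rw [← hs, sq, sum_mul_sum]
  refine sum_congr rfl fun i _ ↦ sum_congr rfl fun j _ ↦ ?_
  cases b i <;> cases b j <;> simp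

open Finset in
lemma mul_sum_middleLayers_agree {n : ℕ} {i j : Fin n} (h : i ≠ j) :
    (n * (n - 1) : ℝ) * ∑ b ∈ middleLayers n, (if b i = b j then (1 : ℝ) else -1) =
      #(middleLayers n) * ((if Odd n then 1 else 0) - n) := by
  set F : Fin n → Fin n → ℝ := fun i j ↦
    ∑ b ∈ middleLayers n, (if b i = b j then (1 : ℝ) else -1) with hF
  have hoff : ∀ i' j', F i' j' =
      F i j + if i' = j' then (#(middleLayers n) : ℝ) - F i j else 0 := by
    intro i' j'
    split_ifs with e
    · subst e
      simp [hF]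
    · rw [add_zero]
      exact sum_middleLayers_agree_congr h e
  have h1 : ∑ i', ∑ j', F i' j' = n * (n - 1) * F i j + n * #(middleLayers n) := by
    rw [sum_congr rfl fun i' _ ↦ sum_congr rfl fun j' _ ↦ hoff i' j']
    simp only [sum_add_distrib, sum_ite_eq, mem_univ, if_true, sum_const, card_univ,
      Fintype.card_fin, nsmul_eq_mul]
    ring
  have h2 : ∑ i', ∑ j', F i' j' = #(middleLayers n) * (if Odd n then 1 else 0) := by
    simp only [hF]
    rw [sum_congr rfl fun i' _ ↦ sum_comm, sum_comm, ← nsmul_eq_mul]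
    refine sum_eq_card_nsmul fun b hb ↦ ?_
    rw [sum_sum_agree]
    simp only [middleLayers, mem_filter, mem_univ, true_and] at hb
    rcases Nat.even_or_odd' n with ⟨m, hm | hm⟩
    · have hw : #{a | b a = true} = m := by omega
      rw [hw, if_neg (by simp [hm]), hm]
      push_cast
      ring
    · have hw : #{a | b a = true} = m ∨ #{a | b a = true} = m + 1 := by omega
      rw [if_pos (by simp [hm])]
      rcases hw with hw | hw <;> rw [hw, hm] <;> push_cast <;> ring
  change (n * (n - 1) : ℝ) * F i j = _
  linarith


/-- let `n ≥ 2`, `k = n` for odd `n` and `k = n−1` for even `n`, and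
`S = { b ∈ 𝔽₂^n : b_n = 0, |b| ∈ {⌊n/2⌋, ⌈n/2⌉} }`. Then `|S| = C(k, ⌊k/2⌋)` and for all
`i ≠ j`, `Σ_{b ∈ S} (−1)^{b_i ⊕ b_j} = −(1/k)·C(k, ⌊k/2⌋)`. -/
theorem stmt_13 {n : ℕ} (hn : 2 ≤ n) (k : ℕ)
    (hk : k = if Odd n then n else n - 1) :
    (Finset.univ.filter (fun b : Fin n → Bool =>
        b ⟨n - 1, by omega⟩ = false ∧
        ((Finset.univ.filter (fun a => b a = true)).card = n / 2 ∨
         (Finset.univ.filter (fun a => b a = true)).card = (n + 1) / 2))).card =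
      k.choose (k / 2) ∧
    ∀ i j : Fin n, i ≠ j →
      (∑ b ∈ Finset.univ.filter (fun b : Fin n → Bool =>
          b ⟨n - 1, by omega⟩ = false ∧
          ((Finset.univ.filter (fun a => b a = true)).card = n / 2 ∨
           (Finset.univ.filter (fun a => b a = true)).card = (n + 1) / 2)),
        (if b i = b j then (1 : ℝ) else -1)) =
      -(1 / (k : ℝ)) * (k.choose (k / 2) : ℝ) := by
  have hS : (Finset.univ.filter (fun b : Fin n → Bool =>
      b ⟨n - 1, by omega⟩ = false ∧
      ((Finset.univ.filter (fun a => b a = true)).card = n / 2 ∨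
       (Finset.univ.filter (fun a => b a = true)).card = (n + 1) / 2))) =
      (middleLayers n).filter (fun b => b ⟨n - 1, by omega⟩ = false) := by
    ext b
    simp [middleLayers, and_comm]
  rw [hS]
  have hcard := card_middleLayers hn hk
  refine ⟨?_, fun i j hij => ?_⟩
  · have h := sum_middleLayers_eq_two_mul (⟨n - 1, by omega⟩ : Fin n) (fun _ => 1) (fun _ => rfl)
    simp only [Finset.sum_const, nsmul_eq_mul, mul_one] at h
    norm_cast at h
    omega
  · have h := sum_middleLayers_eq_two_mul (⟨n - 1, by omega⟩ : Fin n)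
      (fun b => if b i = b j then (1 : ℝ) else -1) (fun b => by simp)
    have hF := mul_sum_middleLayers_agree hij
    rw [h, hcard] at hF
    have hn' : (2 : ℝ) ≤ n := by exact_mod_cast hn
    have hk0 : (k : ℝ) = if Odd n then (n : ℝ) else n - 1 := by
      rw [hk]
      split_ifs
      · rfl
      · rw [Nat.cast_sub (by omega), Nat.cast_one]
    push_cast at hF
    generalize (k.choose (k / 2) : ℝ) = c at hF ⊢
    rw [hk0]
    have hn0 : (n : ℝ) ≠ 0 := by linarith
    have hn1 : (n : ℝ) - 1 ≠ 0 := by linarith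
    split_ifs at hF ⊢ with ho
    · field_simp
      apply mul_left_cancel₀ hn1
      linarith
    · field_simp
      apply mul_left_cancel₀ hn0
      linarith
end
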